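/- The span of typed decorated trees with the grafting products is a 𝒯-multiple prelie algebra: for all t, t' ∈ 𝒯 and all x, y, z ∈ g_{D,𝒯}, x •_{t'} (y •_t z) − (x •_{t'} y) •_t z = x •_t (z •_{t'} y) − (x •_t z) •_{t'} y. -/

import Mathlib

open scoped TensorProduct

/-- Underlying data of a `D`-decorated `T`-typed rooted tree: a root decoration together with a
list of pairs (edge type, subtree). -/
inductive PreTree (D T : Type) : Type
  | node : D → List (T × PreTree D T) → PreTree D T

namespace PreTree
variable {D T : Type}

/-- One-step rearrangement of children; it generates the identification of trees whose children
form the same multiset of (type, subtree) pairs. -/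
inductive Swap : PreTree D T → PreTree D T → Prop
  | swap (d : D) (l₁ l₂ : List (T × PreTree D T)) (p q : T × PreTree D T) :
      Swap (.node d (l₁ ++ p :: q :: l₂)) (.node d (l₁ ++ q :: p :: l₂))
  | congr (d : D) (l₁ l₂ : List (T × PreTree D T)) (t : T) (s s' : PreTree D T) :
      Swap s s' → Swap (.node d (l₁ ++ (t, s) :: l₂)) (.node d (l₁ ++ (t, s') :: l₂))

end PreTree

instance preTreeSetoid (D T : Type) : Setoid (PreTree D T) :=
  ⟨Relation.EqvGen PreTree.Swap, Relation.EqvGen.is_equivalence _⟩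

/-- `D`-decorated `T`-typed rooted trees: the root is decorated by an element of `D` and carries
a finite multiset of pairs (type, subtree). -/
abbrev TypedTree (D T : Type) : Type := Quotient (preTreeSetoid D T)
namespace PreTree
variable {D T : Type}

mutual
/-- The list of all graftings `S •_t^{(v)} S'` of `S'` on a vertex `v` of `S`, the new edge
having type `t` (one entry for each vertex `v` of `S`). -/
def graftAll (t : T) (s' : PreTree D T) : PreTree D T → List (PreTree D T)
  | .node d l => .node d ((t, s') :: l) :: (graftAllL t s' l).map (fun l' => .node d l')
def graftAllL (t : T) (s' : PreTree D T) :
    List (T × PreTree D T) → List (List (T × PreTree D T))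
  | [] => []
  | (u, c) :: rest =>
      ((graftAll t s' c).map fun c' => (u, c') :: rest) ++
      ((graftAllL t s' rest).map fun r => (u, c) :: r)
end

end PreTree

variable (K : Type) [Field K]

/-- `g_{D,T}`: the free `K`-vector space with basis the set of `D`-decorated `T`-typed
rooted trees. -/
abbrev gDT (K D T : Type) [Field K] : Type := TypedTree D T →₀ K

/-- The grafting product `•_t`, defined on basis trees by
`S •_t S' = Σ_{v ∈ V(S)} S •_t^{(v)} S'`, extended bilinearly. -/
noncomputable def bulletL {D T : Type} (t : T) :
    gDT K D T →ₗ[K] gDT K D T →ₗ[K] gDT K D T :=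
  Finsupp.lift (gDT K D T →ₗ[K] gDT K D T) K (TypedTree D T) fun a =>
    Finsupp.lift (gDT K D T) K (TypedTree D T) fun b =>
      ((PreTree.graftAll t b.out a.out).map
        fun r => Finsupp.single (⟦r⟧ : TypedTree D T) (1 : K)).sum

namespace PreTree
variable {D T : Type}

theorem induction_on_children {P : PreTree D T → Prop}
    (h : ∀ d l, (∀ p ∈ l, P p.2) → P (.node d l)) (s : PreTree D T) : P s :=
  PreTree.rec (motive_1 := P) (motive_2 := fun l => ∀ p ∈ l, P p.2) (motive_3 := fun p => P p.2)
    h (by simp) (fun _ _ hp hl => List.forall_mem_cons.2 ⟨hp, hl⟩) (fun _ _ hc => hc) s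

theorem mk_node_append_perm (d : D) {l₁ l₂ : List (T × PreTree D T)} (h : l₁.Perm l₂)
    (l₀ : List (T × PreTree D T)) :
    (⟦.node d (l₀ ++ l₁)⟧ : TypedTree D T) = ⟦.node d (l₀ ++ l₂)⟧ := by
  induction h generalizing l₀ with
  | nil => rfl
  | cons p _ ih => simpa using ih (l₀ ++ [p])
  | swap p q l => exact Quotient.sound (.rel _ _ (.swap d l₀ l q p))
  | trans _ _ ih₁ ih₂ => exact (ih₁ l₀).trans (ih₂ l₀)

theorem mk_node_append_cons (d : D) (l₀ l : List (T × PreTree D T)) (t : T) {s s' : PreTree D T}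
    (h : Relation.EqvGen Swap s s') :
    (⟦.node d (l₀ ++ (t, s) :: l)⟧ : TypedTree D T) = ⟦.node d (l₀ ++ (t, s') :: l)⟧ := by
  induction h with
  | rel _ _ h => exact Quotient.sound (.rel _ _ (.congr d l₀ l t _ _ h))
  | refl => rfl
  | symm _ _ _ ih => exact ih.symm
  | trans _ _ _ _ _ ih₁ ih₂ => exact ih₁.trans ih₂

theorem mk_node_append_map_out (d : D) (l l₀ : List (T × PreTree D T)) :
    (⟦.node d (l₀ ++ l.map fun p => (p.1, (⟦p.2⟧ : TypedTree D T).out))⟧ : TypedTree D T) =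
      ⟦.node d (l₀ ++ l)⟧ := by
  induction l generalizing l₀ with
  | nil => rfl
  | cons p l ih =>
    have h := ih (l₀ ++ [(p.1, (⟦p.2⟧ : TypedTree D T).out)])
    simp only [List.append_assoc, List.singleton_append] at h
    rw [List.map_cons, h]
    exact mk_node_append_cons d l₀ l p.1 (Quotient.mk_out p.2)

end PreTree

namespace TypedTree
variable {D T : Type}

/-- The tree with root decoration `d` and a given multiset of typed subtrees. -/
noncomputable def node (d : D) (m : Multiset (T × TypedTree D T)) : TypedTree D T :=
  ⟦.node d (m.toList.map fun p => (p.1, p.2.out))⟧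

theorem node_coe_map_mk (d : D) (l : List (T × PreTree D T)) :
    node d (l.map fun p => (p.1, (⟦p.2⟧ : TypedTree D T)) : List (T × TypedTree D T)) =
      ⟦.node d l⟧ := by
  have h := (Multiset.coe_eq_coe.1 (Multiset.coe_toList
    (l.map fun p => (p.1, (⟦p.2⟧ : TypedTree D T)) : Multiset (T × TypedTree D T)))).map
      fun p => (p.1, p.2.out)
  refine (PreTree.mk_node_append_perm d h []).trans ?_
  rw [List.map_map]
  exact PreTree.mk_node_append_map_out d l []

end TypedTree

namespace gDT
variable {D T : Type}

/-- The polynomial algebra with basis the forests, i.e. the multisets of typed edges carrying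
trees. -/
abbrev Forest (K D T : Type) [Field K] : Type := MvPolynomial (T × TypedTree D T) K

/-- The linear map sending a tree to the forest consisting of that tree with edge type `t`. -/
noncomputable def plant (t : T) : gDT K D T →ₗ[K] Forest K D T :=
  Finsupp.lift (Forest K D T) K (TypedTree D T) fun c => MvPolynomial.X (t, c)

/-- The linear map attaching all the trees of a forest to a new root decorated by `d`. -/
noncomputable def attach (d : D) : Forest K D T →ₗ[K] gDT K D T :=
  (MvPolynomial.basisMonomials (T × TypedTree D T) K).constr K fun m =>
    Finsupp.single (TypedTree.node d m.toMultiset) 1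

/-- The forest of a list of typed edges carrying trees. -/
noncomputable def forest (l : List (T × PreTree D T)) : Forest K D T :=
  (l.map fun p => MvPolynomial.X (p.1, (⟦p.2⟧ : TypedTree D T))).prod

/-- The sum of all graftings of `s'` on `s` by an edge of type `t`. -/
noncomputable def graftSum (t : T) (s' s : PreTree D T) : gDT K D T :=
  ((PreTree.graftAll t s' s).map fun r => Finsupp.single (⟦r⟧ : TypedTree D T) (1 : K)).sum

/-- The sum of all graftings of `s'` on the trees of a list by an edge of type `t`. -/
noncomputable def graftSumL (t : T) (s' : PreTree D T) (l : List (T × PreTree D T)) :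
    Forest K D T :=
  ((PreTree.graftAllL t s' l).map (forest K)).sum

@[simp]
theorem plant_single (t : T) (c : TypedTree D T) :
    plant K t (Finsupp.single c 1) = MvPolynomial.X (t, c) := by
  simp [plant]

theorem forest_cons (u : T) (c : PreTree D T) (l : List (T × PreTree D T)) :
    forest K ((u, c) :: l) = MvPolynomial.X (u, ⟦c⟧) * forest K l := by
  simp [forest]

theorem forest_append (l₁ l₂ : List (T × PreTree D T)) :
    forest K (l₁ ++ l₂) = forest K l₁ * forest K l₂ := by
  simp [forest]

open Classical in
theorem forest_eq_monomial (l : List (T × PreTree D T)) :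
    forest K l = MvPolynomial.monomial (Multiset.toFinsupp
      (l.map fun p => (p.1, (⟦p.2⟧ : TypedTree D T)) : Multiset (T × TypedTree D T))) 1 := by
  induction l with
  | nil => simp [forest]
  | cons p l ih =>
    rw [forest_cons, ih, MvPolynomial.X, MvPolynomial.monomial_mul, List.map_cons,
      ← Multiset.cons_coe, ← Multiset.singleton_add, map_add, Multiset.toFinsupp_singleton, one_mul]

open Classical in
theorem attach_forest (d : D) (l : List (T × PreTree D T)) :
    attach K d (forest K l) = Finsupp.single ⟦.node d l⟧ 1 := by
  have h := (MvPolynomial.basisMonomials (T × TypedTree D T) K).constr_basis K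
    (fun m => (Finsupp.single (TypedTree.node d m.toMultiset) 1 : gDT K D T))
  simp only [MvPolynomial.coe_basisMonomials] at h
  rw [forest_eq_monomial, attach, h, Multiset.toFinsupp_toMultiset, TypedTree.node_coe_map_mk]

open Classical in
theorem exists_forest_eq_monomial (m : T × TypedTree D T →₀ ℕ) :
    ∃ l, forest K l = MvPolynomial.monomial m 1 := by
  refine ⟨m.toMultiset.toList.map fun p => (p.1, p.2.out), ?_⟩
  rw [forest_eq_monomial, List.map_map]
  simp only [Function.comp_def, Quotient.out_eq, Prod.mk.eta, List.map_id', Multiset.coe_toList,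
    Finsupp.toMultiset_toFinsupp]

theorem graftSum_node (t : T) (s' : PreTree D T) (d : D) (l : List (T × PreTree D T)) :
    graftSum K t s' (.node d l) =
      attach K d (MvPolynomial.X (t, ⟦s'⟧) * forest K l + graftSumL K t s' l) := by
  simp [graftSum, graftSumL, PreTree.graftAll, ← forest_cons, attach_forest, map_list_sum,
    Function.comp_def]

theorem graftSumL_cons (t : T) (s' : PreTree D T) (u : T) (c : PreTree D T)
    (l : List (T × PreTree D T)) :
    graftSumL K t s' ((u, c) :: l) =
      plant K u (graftSum K t s' c) * forest K l +
        MvPolynomial.X (u, ⟦c⟧) * graftSumL K t s' l := by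
  simp [graftSum, graftSumL, PreTree.graftAllL, forest_cons, map_list_sum, Function.comp_def,
    List.sum_map_mul_left, List.sum_map_mul_right]

theorem graftSumL_append (t : T) (s' : PreTree D T) (l₁ l₂ : List (T × PreTree D T)) :
    graftSumL K t s' (l₁ ++ l₂) =
      graftSumL K t s' l₁ * forest K l₂ + forest K l₁ * graftSumL K t s' l₂ := by
  induction l₁ with
  | nil => simp [graftSumL, forest, PreTree.graftAllL]
  | cons p l₁ ih =>
    rw [List.cons_append, graftSumL_cons, ih, graftSumL_cons, forest_append, forest_cons]
    ring

theorem graftSum_congr_right (t : T) {s s' : PreTree D T}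
    (h : (⟦s⟧ : TypedTree D T) = ⟦s'⟧) (a : PreTree D T) :
    graftSum K t s a = graftSum K t s' a := by
  induction a using PreTree.induction_on_children with
  | h d l ih =>
    have hl : graftSumL K t s l = graftSumL K t s' l := by
      clear d
      induction l with
      | nil => simp [graftSumL, PreTree.graftAllL]
      | cons p l ihl =>
        rw [graftSumL_cons, graftSumL_cons, ih p (by simp),
          ihl fun q hq => ih q (List.mem_cons_of_mem _ hq)]
    rw [graftSum_node, graftSum_node, h, hl]

theorem graftSum_swap (t : T) (s' : PreTree D T) {a b : PreTree D T} (h : PreTree.Swap a b) :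
    graftSum K t s' a = graftSum K t s' b := by
  induction h with
  | swap d l₁ l₂ p q =>
    obtain ⟨u, p⟩ := p
    obtain ⟨v, q⟩ := q
    simp only [graftSum_node, graftSumL_append, graftSumL_cons, forest_append, forest_cons]
    refine congrArg (attach K d) ?_
    ring
  | congr d l₁ l₂ u c c' hc ih =>
    have hmk : (⟦c⟧ : TypedTree D T) = ⟦c'⟧ := Quotient.sound (.rel _ _ hc)
    simp only [graftSum_node, graftSumL_append, graftSumL_cons, forest_append, forest_cons, ih,
      hmk]

theorem graftSum_congr_left (t : T) (s' : PreTree D T) {a b : PreTree D T}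
    (h : Relation.EqvGen PreTree.Swap a b) : graftSum K t s' a = graftSum K t s' b := by
  induction h with
  | rel _ _ h => exact graftSum_swap K t s' h
  | refl => rfl
  | symm _ _ _ ih => exact ih.symm
  | trans _ _ _ _ _ ih₁ ih₂ => exact ih₁.trans ih₂

theorem bulletL_single_single (t : T) (s s' : PreTree D T) :
    bulletL K t (Finsupp.single ⟦s⟧ 1) (Finsupp.single ⟦s'⟧ 1) = graftSum K t s' s := by
  have h : bulletL K t (Finsupp.single ⟦s⟧ 1) (Finsupp.single ⟦s'⟧ 1) =
      graftSum K t (⟦s'⟧ : TypedTree D T).out (⟦s⟧ : TypedTree D T).out := by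
    simp [bulletL, graftSum]
  rw [h, graftSum_congr_right K t (Quotient.out_eq _),
    graftSum_congr_left K t s' (Quotient.mk_out s)]

/-- Grafting on the trees of a forest, as a derivation of the algebra of forests. -/
noncomputable def graftDerivation (t : T) :
    gDT K D T →ₗ[K] Derivation K (Forest K D T) (Forest K D T) :=
  (MvPolynomial.mkDerivationEquiv K).toLinearMap ∘ₗ
    LinearMap.pi fun p : T × TypedTree D T => plant K p.1 ∘ₗ bulletL K t (Finsupp.single p.2 1)

theorem graftDerivation_X (t : T) (b : gDT K D T) (p : T × TypedTree D T) :
    graftDerivation K t b (MvPolynomial.X p) =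
      plant K p.1 (bulletL K t (Finsupp.single p.2 1) b) :=
  MvPolynomial.mkDerivation_X _ _ _

theorem graftDerivation_plant (t u : T) (b c : gDT K D T) :
    graftDerivation K t b (plant K u c) = plant K u (bulletL K t c b) := by
  induction c using Finsupp.induction_linear with
  | zero => simp
  | add c₁ c₂ h₁ h₂ => simp [h₁, h₂]
  | single c k =>
    rw [← mul_one k, ← smul_eq_mul, ← Finsupp.smul_single]
    simp only [map_smul, LinearMap.smul_apply, plant_single, Derivation.map_smul,
      graftDerivation_X]

theorem graftDerivation_single_forest (t : T) (s' : PreTree D T) (l : List (T × PreTree D T)) :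
    graftDerivation K t (Finsupp.single ⟦s'⟧ 1) (forest K l) = graftSumL K t s' l := by
  induction l with
  | nil => simp [forest, graftSumL, PreTree.graftAllL]
  | cons p l ih =>
    rw [forest_cons, Derivation.leibniz, graftDerivation_X, bulletL_single_single, ih,
      graftSumL_cons, smul_eq_mul, smul_eq_mul]
    ring

theorem bulletL_attach (t : T) (d : D) (f : Forest K D T) (b : gDT K D T) :
    bulletL K t (attach K d f) b = attach K d (plant K t b * f + graftDerivation K t b f) := by
  induction b using Finsupp.induction_linear with
  | zero => simp
  | add b₁ b₂ h₁ h₂ =>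
    simp only [map_add, h₁, h₂, add_mul, Derivation.add_apply]
    abel
  | single b k =>
    induction f using MvPolynomial.induction_on' with
    | add f g hf hg =>
      simp only [map_add, LinearMap.add_apply, hf, hg, mul_add]
      abel
    | monomial m a =>
      obtain ⟨l, hl⟩ := exists_forest_eq_monomial K m
      induction b using Quotient.inductionOn with
      | h s' =>
        have h : bulletL K t (attach K d (forest K l)) (Finsupp.single ⟦s'⟧ 1) =
            attach K d (plant K t (Finsupp.single ⟦s'⟧ 1) * forest K l +
              graftDerivation K t (Finsupp.single ⟦s'⟧ 1) (forest K l)) := by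
          rw [attach_forest, bulletL_single_single, graftSum_node, plant_single,
            graftDerivation_single_forest]
        rw [← mul_one k, ← mul_one a, ← smul_eq_mul k, ← smul_eq_mul a, ← Finsupp.smul_single,
          ← MvPolynomial.smul_monomial, ← hl]
        simp only [map_smul, LinearMap.smul_apply, Derivation.smul_apply, h, smul_mul_assoc,
          mul_smul_comm, Derivation.map_smul, map_add, smul_add, smul_comm k a]

theorem lie_graftDerivation_forest (t t' : T) (y z : gDT K D T) (l : List (T × PreTree D T))
    (h : ∀ p ∈ l,
      bulletL K t' (Finsupp.single ⟦p.2⟧ 1) (bulletL K t y z) -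
          bulletL K t (bulletL K t' (Finsupp.single ⟦p.2⟧ 1) y) z =
        bulletL K t (Finsupp.single ⟦p.2⟧ 1) (bulletL K t' z y) -
          bulletL K t' (bulletL K t (Finsupp.single ⟦p.2⟧ 1) z) y) :
    ⁅graftDerivation K t z, graftDerivation K t' y⁆ (forest K l) =
      graftDerivation K t' (bulletL K t y z) (forest K l) -
        graftDerivation K t (bulletL K t' z y) (forest K l) := by
  induction l with
  | nil => simp [forest]
  | cons p l ih =>
    have hp := congrArg (plant K p.1) (h p (by simp))
    simp only [map_sub] at hp
    rw [forest_cons, Derivation.leibniz, Derivation.leibniz, Derivation.leibniz,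
      ih fun q hq => h q (List.mem_cons_of_mem _ hq), Derivation.commutator_apply]
    simp only [graftDerivation_X, graftDerivation_plant, smul_eq_mul]
    linear_combination (-forest K l) * hp

theorem prelie_single (t t' : T) (y z : gDT K D T) (s : PreTree D T) :
    bulletL K t' (Finsupp.single ⟦s⟧ 1) (bulletL K t y z) -
        bulletL K t (bulletL K t' (Finsupp.single ⟦s⟧ 1) y) z =
      bulletL K t (Finsupp.single ⟦s⟧ 1) (bulletL K t' z y) -
        bulletL K t' (bulletL K t (Finsupp.single ⟦s⟧ 1) z) y := by
  induction s using PreTree.induction_on_children with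
  | h d l ih =>
    have h := lie_graftDerivation_forest K t t' y z l ih
    rw [Derivation.commutator_apply] at h
    simp only [← attach_forest, bulletL_attach, ← map_sub]
    refine congrArg (attach K d) ?_
    simp only [map_add, Derivation.leibniz, graftDerivation_plant, smul_eq_mul]
    linear_combination -h

end gDT

/-- `(g_{D,𝒯}, (•_t)_{t∈𝒯})` is a `𝒯`-multiple prelie algebra: for all
`t, t' ∈ 𝒯` and all `x, y, z ∈ g_{D,𝒯}`,
`x •_{t'} (y •_t z) − (x •_{t'} y) •_t z = x •_t (z •_{t'} y) − (x •_t z) •_{t'} y`. -/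
theorem gDT_multiple_prelie (K : Type) [Field K] (D T : Type) [Nonempty D] [Nonempty T]
    (t t' : T) (x y z : gDT K D T) :
    bulletL K t' x (bulletL K t y z) - bulletL K t (bulletL K t' x y) z =
      bulletL K t x (bulletL K t' z y) - bulletL K t' (bulletL K t x z) y := by
  induction x using Finsupp.induction_linear with
  | zero => simp
  | add x₁ x₂ h₁ h₂ =>
    simp only [map_add, LinearMap.add_apply, add_sub_add_comm, h₁, h₂]
  | single s k =>
    induction s using Quotient.inductionOn with
    | h s =>
      rw [← mul_one k, ← smul_eq_mul, ← Finsupp.smul_single]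
      simp only [map_smul, LinearMap.smul_apply, ← smul_sub, gDT.prelie_single]
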